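/- arXiv:1203.6877 — 7 statements merged into one kernel-verified Lean document; each statement's English description precedes it below -/
import Mathlib

section
/- Let m ∈ ℝ, ψ < m, and let h : ℝ → ℝ be concave on (−∞, m] with h(m) ≥ 0. Define H : (−∞, m] → ℝ by H(x) := h(x) for x ≤ ψ and H(x) := h(ψ)·(m − x)/(m − ψ) for ψ ≤ x ≤ m. Then H is concave on (−∞, m]. -/
/-- If `f` is concave on `(−∞, m]` with `f m ≥ 0`, then `(m - a) * f b` dominates
`(m - b) * f a` whenever `a ≤ b ≤ m`. -/
theorem ConcaveOn.sub_mul_le_sub_mul_of_nonneg_right {m a b : ℝ} {f : ℝ → ℝ}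
    (hf : ConcaveOn ℝ (Set.Iic m) f) (hm : 0 ≤ f m) (hab : a ≤ b) (hbm : b ≤ m) :
    (m - b) * f a ≤ (m - a) * f b := by
  rcases hab.eq_or_lt with rfl | hab
  · rfl
  rcases hbm.eq_or_lt with rfl | hbm
  · simpa using mul_nonneg (sub_nonneg.2 hab.le) hm
  have hslope := hf.slope_anti_adjacent (Set.mem_Iic.2 (hab.trans hbm).le) Set.self_mem_Iic hab hbm
  rw [div_le_div_iff₀ (sub_pos.2 hbm) (sub_pos.2 hab)] at hslope
  nlinarith [mul_nonneg (sub_nonneg.2 hab.le) hm]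

/-- Gluing lemma for concavity: if `h` is concave on `(−∞, m]` with `h m ≥ 0`
and `ψ < m`, then the function equal to `h` on `(−∞, ψ]` and to the linear
function `x ↦ h ψ · (m − x)/(m − ψ)` on `[ψ, m]` is concave on `(−∞, m]`. -/
theorem concave_glue_linear
    (m ψ : ℝ) (hψ : ψ < m) (h : ℝ → ℝ)
    (hconc : ConcaveOn ℝ (Set.Iic m) h) (hm : 0 ≤ h m)
    (H : ℝ → ℝ)
    (hH₁ : ∀ x, x ≤ ψ → H x = h x)
    (hH₂ : ∀ x, ψ ≤ x → x ≤ m → H x = h ψ * (m - x) / (m - ψ)) :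
    ConcaveOn ℝ (Set.Iic m) H := by
  have hpos : 0 < m - ψ := sub_pos.2 hψ
  have hlin : ConcaveOn ℝ (Set.Iic m) fun x => h ψ * (m - x) / (m - ψ) := by
    refine ⟨convex_Iic m, fun x _ y _ a b _ _ hab => le_of_eq ?_⟩
    obtain rfl : b = 1 - a := by linarith
    simp only [smul_eq_mul]
    ring
  refine (hconc.inf hlin).congr fun x hx => ?_
  rw [Pi.inf_apply]
  rcases le_total x ψ with hxψ | hxψ
  · rw [hH₁ x hxψ, inf_eq_left, le_div_iff₀ hpos]
    linarith [hconc.sub_mul_le_sub_mul_of_nonneg_right hm hxψ hψ.le]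
  · rw [hH₂ x hxψ hx, inf_eq_right, div_le_iff₀ hpos]
    linarith [hconc.sub_mul_le_sub_mul_of_nonneg_right hm hxψ hx]
end

section
/- Let v : ℝ² → ℝ be C², λ : ℝ → ℝ be C², and ψ : ℝ → ℝ be C¹ with ψ(m) < m for all m. Define γ_v(x, m) := ∂²_{xm} v(x, m) + ∂_m v(x, m)/(m − x) for x < m, and assume that for all m: −ψ′(m) · (∂²_{xx} v(ψ(m), m) − λ″(ψ(m))) = γ_v(ψ(m), m). Define w(x, m) := v(min(x, ψ(m)), m) − λ(min(x, ψ(m))) + (x − ψ(m))^+ · (∂_x v(ψ(m), m) − λ′(ψ(m))). Then for every m: ∂_m w(x, m) = ∂_m v(x, m) for all x < ψ(m), and ∂_m w(x, m) = ∂_m v(ψ(m), m) · (m − x)/(m − ψ(m)) for all x with ψ(m) < x ≤ m. -/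
/-- The total derivative of `t ↦ f (g t) t` in terms of the partial derivatives of `f`. -/
theorem hasDerivAt_comp_graph {f : ℝ → ℝ → ℝ} {g : ℝ → ℝ} {a b g' t : ℝ}
    (hf : DifferentiableAt ℝ (Function.uncurry f) (g t, t))
    (hx : HasDerivAt (fun x => f x t) a (g t)) (ht : HasDerivAt (fun s => f (g t) s) b t)
    (hg : HasDerivAt g g' t) :
    HasDerivAt (fun s => f (g s) s) (a * g' + b) t := by
  set L := fderiv ℝ (Function.uncurry f) (g t, t)
  have hL : HasFDerivAt (Function.uncurry f) L (g t, t) := hf.hasFDerivAt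
  have ha : L (1, 0) = a :=
    (hL.comp_hasDerivAt (f := fun x => (x, t)) (g t)
      ((hasDerivAt_id (g t)).prodMk (hasDerivAt_const (g t) t))).unique hx
  have hb : L (0, 1) = b :=
    (hL.comp_hasDerivAt (f := fun s => (g t, s)) t
      ((hasDerivAt_const t (g t)).prodMk (hasDerivAt_id t))).unique ht
  have h : HasDerivAt (fun s => f (g s) s) (L (g', 1)) t :=
    hL.comp_hasDerivAt (f := fun s => (g s, s)) t (hg.prodMk (hasDerivAt_id t))
  have hsplit : L (g', 1) = a * g' + b := by
    rw [show ((g', 1) : ℝ × ℝ) = g' • (1, 0) + (0, 1) by simp, map_add, map_smul, ha, hb,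
      smul_eq_mul, mul_comm]
  rwa [hsplit] at h

/-- The first partial derivative of a `C²` function of two variables is jointly differentiable. -/
theorem differentiable_uncurry_partial_fst {f fx : ℝ → ℝ → ℝ}
    (hf : ContDiff ℝ 2 (Function.uncurry f))
    (hfx : ∀ x t, HasDerivAt (fun y => f y t) (fx x t) x) :
    Differentiable ℝ (Function.uncurry fx) := by
  have heq : Function.uncurry fx = fun p => fderiv ℝ (Function.uncurry f) p (1, 0) := by
    funext ⟨x, t⟩
    have hL := (hf.differentiable (by norm_num) (x, t)).hasFDerivAt
    exact (hfx x t).unique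
      (hL.comp_hasDerivAt (f := fun y => (y, t)) x
        ((hasDerivAt_id x).prodMk (hasDerivAt_const x t)))
  rw [heq]
  have h1 : ContDiff ℝ 1 (fderiv ℝ (Function.uncurry f)) :=
    hf.fderiv_right (by norm_num)
  exact (h1.differentiable (by norm_num)).clm_apply (differentiable_const _)


/-- The `m`-derivative of the one-step candidate value function: with `v` C²,
`λ` C², `ψ` C¹ with `ψ(m) < m` satisfying the free-boundary ODE
`−ψ′(m)·(∂²ₓₓv(ψ(m),m) − λ″(ψ(m))) = γ_v(ψ(m),m)` where
`γ_v(x,m) = ∂²ₓₘv(x,m) + ∂ₘv(x,m)/(m−x)`, and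
`w(x,m) = v(x∧ψ(m),m) − λ(x∧ψ(m)) + (x−ψ(m))⁺·(∂ₓv(ψ(m),m) − λ′(ψ(m)))`,
one has `∂ₘw(x,m) = ∂ₘv(x,m)` for `x < ψ(m)` and
`∂ₘw(x,m) = ∂ₘv(ψ(m),m)·(m−x)/(m−ψ(m))` for `ψ(m) < x ≤ m`. -/
theorem one_step_value_m_derivative
    (v : ℝ → ℝ → ℝ) (hv : ContDiff ℝ 2 (Function.uncurry v))
    (vx vm vxx vxm : ℝ → ℝ → ℝ)
    (hvx : ∀ x m, HasDerivAt (fun x' => v x' m) (vx x m) x)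
    (hvm : ∀ x m, HasDerivAt (fun m' => v x m') (vm x m) m)
    (hvxx : ∀ x m, HasDerivAt (fun x' => vx x' m) (vxx x m) x)
    (hvxm : ∀ x m, HasDerivAt (fun m' => vx x m') (vxm x m) m)
    (lam : ℝ → ℝ) (hlam : ContDiff ℝ 2 lam)
    (lam' lam'' : ℝ → ℝ)
    (hlam' : ∀ x, HasDerivAt lam (lam' x) x)
    (hlam'' : ∀ x, HasDerivAt lam' (lam'' x) x)
    (ψ : ℝ → ℝ) (hψ : ContDiff ℝ 1 ψ)
    (ψ' : ℝ → ℝ) (hψ' : ∀ m, HasDerivAt ψ (ψ' m) m)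
    (hψlt : ∀ m, ψ m < m)
    (γv : ℝ → ℝ → ℝ) (hγv : ∀ x m, γv x m = vxm x m + vm x m / (m - x))
    (hode : ∀ m, -ψ' m * (vxx (ψ m) m - lam'' (ψ m)) = γv (ψ m) m)
    (w : ℝ → ℝ → ℝ)
    (hw : ∀ x m, w x m = v (min x (ψ m)) m - lam (min x (ψ m))
        + max (x - ψ m) 0 * (vx (ψ m) m - lam' (ψ m))) :
    ∀ m x : ℝ,
      (x < ψ m → HasDerivAt (fun m' => w x m') (vm x m) m) ∧
      (ψ m < x → x ≤ m →
        HasDerivAt (fun m' => w x m') (vm (ψ m) m * (m - x) / (m - ψ m)) m) := by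
  intro m x
  have hψc : ContinuousAt ψ m := (hψ' m).continuousAt
  refine ⟨fun hx => ?_, fun hx _ => ?_⟩
  · refine ((hvm x m).sub_const (lam x)).congr_of_eventuallyEq ?_
    filter_upwards [hψc.eventually_const_lt hx] with s hs
    simp [hw, min_eq_left hs.le, max_eq_right (sub_nonpos.2 hs.le)]
  · have hV := hasDerivAt_comp_graph (hv.differentiable (by norm_num) (ψ m, m))
      (hvx (ψ m) m) (hvm (ψ m) m) (hψ' m)
    have hVx := hasDerivAt_comp_graph (differentiable_uncurry_partial_fst hv hvx (ψ m, m))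
      (hvxx (ψ m) m) (hvxm (ψ m) m) (hψ' m)
    have hl := (hlam' (ψ m)).comp m (hψ' m)
    have hl' := (hlam'' (ψ m)).comp m (hψ' m)
    have hmain := (hV.sub hl).add (((hψ' m).const_sub x).mul (hVx.sub hl'))
    refine (hmain.congr_of_eventuallyEq ?_).congr_deriv ?_
    · filter_upwards [hψc.eventually_lt_const hx] with s hs
      simp [hw, min_eq_right hs.le, max_eq_left (sub_nonneg.2 hs.le)]
    · have hne : m - ψ m ≠ 0 := (sub_pos.2 (hψlt m)).ne'
      have hode_m := hode m
      rw [hγv] at hode_m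
      have hfrac : vm (ψ m) m * (m - x) / (m - ψ m)
          = vm (ψ m) m - (x - ψ m) * (vm (ψ m) m / (m - ψ m)) := by
        field_simp
        ring
      rw [hfrac]
      simp only [Pi.sub_apply, Function.comp_apply]
      linear_combination (-(x - ψ m)) * hode_m
end

section
/- Let v : ℝ² → ℝ be C², λ : ℝ → ℝ be C², and ψ : ℝ → ℝ be C¹ with ψ(m) < m for all m, and define γ_v(x, m) := ∂²_{xm} v(x, m) + ∂_m v(x, m)/(m − x) for x < m. Assume that for all m: −ψ′(m) · (∂²_{xx} v(ψ(m), m) − λ″(ψ(m))) = γ_v(ψ(m), m), and define w(x, m) := v(min(x, ψ(m)), m) − λ(min(x, ψ(m))) + (x − ψ(m))^+ · (∂_x v(ψ(m), m) − λ′(ψ(m))). Define γ_w(x, m) := ∂_x[∂_m w](x, m) + ∂_m w(x, m)/(m − x) wherever ∂_m w is differentiable in x. Then for every m: γ_w(x, m) = γ_v(x, m) for all x < ψ(m), and γ_w(x, m) = 0 for all x with ψ(m) < x < m. -/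
open Filter Topology

theorem hasDerivAt_comp_pair {E : Type*} [NormedAddCommGroup E] [NormedSpace ℝ E]
    {G : ℝ × ℝ → E} {p q : ℝ → ℝ} {p' q' t : ℝ} {L : ℝ × ℝ →L[ℝ] E}
    (hG : HasFDerivAt G L (p t, q t)) (hp : HasDerivAt p p' t) (hq : HasDerivAt q q' t) :
    HasDerivAt (fun s => G (p s, q s)) (L (p', q')) t :=
  HasFDerivAt.comp_hasDerivAt (f := fun s => (p s, q s)) t hG (hp.prodMk hq)

theorem hasDerivAt_comp_pair_apply {E : Type*} [NormedAddCommGroup E] [NormedSpace ℝ E]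
    {G : ℝ × ℝ → E →L[ℝ] ℝ} {p q : ℝ → ℝ} {p' q' t : ℝ} {L : ℝ × ℝ →L[ℝ] E →L[ℝ] ℝ}
    (hG : HasFDerivAt G L (p t, q t)) (hp : HasDerivAt p p' t) (hq : HasDerivAt q q' t)
    (u : E) : HasDerivAt (fun s => G (p s, q s) u) (L (p', q') u) t := by
  have h := (hasDerivAt_comp_pair hG hp hq).clm_apply (hasDerivAt_const t u)
  rwa [map_zero, add_zero] at h

/-- The total derivative along the curve `t ↦ (p t, t)`, in terms of partial derivatives. -/
theorem hasDerivAt_along_graph {F : ℝ → ℝ → ℝ} {p : ℝ → ℝ} {a b p' m : ℝ}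
    (hF : DifferentiableAt ℝ (Function.uncurry F) (p m, m))
    (ha : HasDerivAt (fun x => F x m) a (p m))
    (hb : HasDerivAt (fun t => F (p m) t) b m) (hp : HasDerivAt p p' m) :
    HasDerivAt (fun t => F (p t) t) (a * p' + b) m := by
  have hL := hF.hasFDerivAt
  set L := fderiv ℝ (Function.uncurry F) (p m, m)
  have ha' : L (1, 0) = a :=
    (hasDerivAt_comp_pair hL (hasDerivAt_id' (p m)) (hasDerivAt_const (p m) m)).unique ha
  have hb' : L (0, 1) = b :=
    (hasDerivAt_comp_pair hL (hasDerivAt_const m (p m)) (hasDerivAt_id' m)).unique hb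
  have hcurve : HasDerivAt (fun t => F (p t) t) (L (p', 1)) m :=
    hasDerivAt_comp_pair hL hp (hasDerivAt_id' m)
  have hsplit : ((p', 1) : ℝ × ℝ) = p' • (1, 0) + (0, 1) := by simp
  rwa [hsplit, map_add, map_smul, ha', hb', smul_eq_mul, mul_comm] at hcurve

/-- The first partial derivative is the Fréchet derivative applied to `(1, 0)`. -/
theorem fst_partial_eq_fderiv {v vx : ℝ → ℝ → ℝ}
    (hv : Differentiable ℝ (Function.uncurry v))
    (hvx : ∀ x m, HasDerivAt (fun x' => v x' m) (vx x m) x) (x m : ℝ) :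
    vx x m = fderiv ℝ (Function.uncurry v) (x, m) (1, 0) :=
  (hvx x m).unique (hasDerivAt_comp_pair (hv (x, m)).hasFDerivAt
    (hasDerivAt_id' x) (hasDerivAt_const x m))

/-- The second partial derivative is the Fréchet derivative applied to `(0, 1)`. -/
theorem snd_partial_eq_fderiv {v vm : ℝ → ℝ → ℝ}
    (hv : Differentiable ℝ (Function.uncurry v))
    (hvm : ∀ x m, HasDerivAt (fun m' => v x m') (vm x m) m) (x m : ℝ) :
    vm x m = fderiv ℝ (Function.uncurry v) (x, m) (0, 1) :=
  (hvm x m).unique (hasDerivAt_comp_pair (hv (x, m)).hasFDerivAt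
    (hasDerivAt_const m x) (hasDerivAt_id' m))

theorem differentiable_fderiv_of_contDiff_two {f : ℝ × ℝ → ℝ} (hf : ContDiff ℝ 2 f) :
    Differentiable ℝ (fderiv ℝ f) :=
  (hf.fderiv_right (m := 1) (by norm_num)).differentiable (by norm_num)

theorem differentiable_fst_partial {v vx : ℝ → ℝ → ℝ}
    (hv : ContDiff ℝ 2 (Function.uncurry v))
    (hvx : ∀ x m, HasDerivAt (fun x' => v x' m) (vx x m) x) :
    Differentiable ℝ (Function.uncurry vx) := by
  have h : Function.uncurry vx = fun q => fderiv ℝ (Function.uncurry v) q (1, 0) :=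
    funext fun q => fst_partial_eq_fderiv (hv.differentiable (by norm_num)) hvx q.1 q.2
  rw [h]
  exact (differentiable_fderiv_of_contDiff_two hv).clm_apply (differentiable_const _)

/-- Symmetry of the mixed second partial derivatives of a `C²` function. -/
theorem hasDerivAt_mixed_partial {v vx vm vxm : ℝ → ℝ → ℝ}
    (hv : ContDiff ℝ 2 (Function.uncurry v))
    (hvx : ∀ x m, HasDerivAt (fun x' => v x' m) (vx x m) x)
    (hvm : ∀ x m, HasDerivAt (fun m' => v x m') (vm x m) m)
    (hvxm : ∀ x m, HasDerivAt (fun m' => vx x m') (vxm x m) m) (x m : ℝ) :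
    HasDerivAt (fun x' => vm x' m) (vxm x m) x := by
  have hd : Differentiable ℝ (Function.uncurry v) := hv.differentiable (by norm_num)
  have hD := (differentiable_fderiv_of_contDiff_two hv (x, m)).hasFDerivAt
  set D := fderiv ℝ (fderiv ℝ (Function.uncurry v)) (x, m)
  have hsymm : D (1, 0) (0, 1) = D (0, 1) (1, 0) :=
    (hv.contDiffAt.isSymmSndFDerivAt (x := (x, m)) (by simp)) (1, 0) (0, 1)
  have hxm : vxm x m = D (0, 1) (1, 0) := by
    refine (hvxm x m).unique ?_
    simp only [fst_partial_eq_fderiv hd hvx]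
    exact hasDerivAt_comp_pair_apply hD (hasDerivAt_const m x) (hasDerivAt_id' m) _
  rw [hxm, ← hsymm]
  simp only [snd_partial_eq_fderiv hd hvm]
  exact hasDerivAt_comp_pair_apply hD (hasDerivAt_id' x) (hasDerivAt_const x m) _

/-- Passing from `v` to the one-step candidate value function `w` kills the
quantity `γ` above the free boundary and leaves it unchanged below: with
`γ_w(x,m) = ∂ₓ[∂ₘw](x,m) + ∂ₘw(x,m)/(m−x)`, one has `γ_w(x,m) = γ_v(x,m)` for
`x < ψ(m)` and `γ_w(x,m) = 0` for `ψ(m) < x < m`. -/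
theorem one_step_value_gamma
    (v : ℝ → ℝ → ℝ) (hv : ContDiff ℝ 2 (Function.uncurry v))
    (vx vm vxx vxm : ℝ → ℝ → ℝ)
    (hvx : ∀ x m, HasDerivAt (fun x' => v x' m) (vx x m) x)
    (hvm : ∀ x m, HasDerivAt (fun m' => v x m') (vm x m) m)
    (hvxx : ∀ x m, HasDerivAt (fun x' => vx x' m) (vxx x m) x)
    (hvxm : ∀ x m, HasDerivAt (fun m' => vx x m') (vxm x m) m)
    (lam : ℝ → ℝ) (hlam : ContDiff ℝ 2 lam)
    (lam' lam'' : ℝ → ℝ)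
    (hlam' : ∀ x, HasDerivAt lam (lam' x) x)
    (hlam'' : ∀ x, HasDerivAt lam' (lam'' x) x)
    (ψ : ℝ → ℝ) (hψ : ContDiff ℝ 1 ψ)
    (ψ' : ℝ → ℝ) (hψ' : ∀ m, HasDerivAt ψ (ψ' m) m)
    (hψlt : ∀ m, ψ m < m)
    (γv : ℝ → ℝ → ℝ) (hγv : ∀ x m, γv x m = vxm x m + vm x m / (m - x))
    (hode : ∀ m, -ψ' m * (vxx (ψ m) m - lam'' (ψ m)) = γv (ψ m) m)
    (w : ℝ → ℝ → ℝ)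
    (hw : ∀ x m, w x m = v (min x (ψ m)) m - lam (min x (ψ m))
        + max (x - ψ m) 0 * (vx (ψ m) m - lam' (ψ m)))
    (wm : ℝ → ℝ → ℝ) (hwm : ∀ x m, wm x m = deriv (fun m' => w x m') m)
    (γw : ℝ → ℝ → ℝ)
    (hγw : ∀ x m, γw x m = deriv (fun x' => wm x' m) x + wm x m / (m - x)) :
    ∀ m x : ℝ,
      (x < ψ m → γw x m = γv x m) ∧
      (ψ m < x → x < m → γw x m = 0) := by
  intro m x
  have hψc : ContinuousAt ψ m := (hψ' m).continuousAt
  constructor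
  · intro hx
    have hwm_below : ∀ y, y < ψ m → wm y m = vm y m := by
      intro y hy
      have hev : (fun m' => w y m') =ᶠ[𝓝 m] fun m' => v y m' - lam y := by
        filter_upwards [hψc.eventually_const_lt hy] with t ht
        rw [hw, min_eq_left ht.le, max_eq_right (sub_nonpos.2 ht.le)]
        ring
      rw [hwm, hev.deriv_eq]
      exact ((hvm y m).sub_const _).deriv
    have hev : (fun x' => wm x' m) =ᶠ[𝓝 x] fun x' => vm x' m := by
      filter_upwards [Iio_mem_nhds hx] with y hy using hwm_below y hy
    rw [hγw, hγv, hev.deriv_eq, (hasDerivAt_mixed_partial hv hvx hvm hvxm x m).deriv,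
      hwm_below x hx]
  · intro hx hxm
    have hmψ : m - ψ m ≠ 0 := (sub_pos.2 (hψlt m)).ne'
    have hmx : m - x ≠ 0 := (sub_pos.2 hxm).ne'
    have hwm_above : ∀ y, ψ m < y → wm y m = vm (ψ m) m / (m - ψ m) * (m - y) := by
      intro y hy
      have hev : (fun m' => w y m') =ᶠ[𝓝 m] fun m' => v (ψ m') m' - lam (ψ m')
          + (y - ψ m') * (vx (ψ m') m' - lam' (ψ m')) := by
        filter_upwards [hψc.eventually_lt_const hy] with t ht
        rw [hw, min_eq_right ht.le, max_eq_left (sub_nonneg.2 ht.le)]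
      have hv_graph := hasDerivAt_along_graph (hv.differentiable (by norm_num) (ψ m, m))
        (hvx (ψ m) m) (hvm (ψ m) m) (hψ' m)
      have hvx_graph := hasDerivAt_along_graph (differentiable_fst_partial hv hvx (ψ m, m))
        (hvxx (ψ m) m) (hvxm (ψ m) m) (hψ' m)
      have hlam_graph := (hlam' (ψ m)).comp m (hψ' m)
      have hlam'_graph := (hlam'' (ψ m)).comp m (hψ' m)
      have hderiv := (hv_graph.sub hlam_graph).add
        (((hψ' m).const_sub y).mul (hvx_graph.sub hlam'_graph))
      rw [hwm, hev.deriv_eq]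
      refine hderiv.deriv.trans ?_
      have hslope : vxx (ψ m) m * ψ' m + vxm (ψ m) m - lam'' (ψ m) * ψ' m
          = -(vm (ψ m) m / (m - ψ m)) := by
        have h := hode m
        rw [hγv] at h
        linarith
      simp only [Pi.sub_apply, Function.comp_apply]
      rw [hslope]
      field_simp
      ring
    have hev : (fun x' => wm x' m) =ᶠ[𝓝 x] fun x' => vm (ψ m) m / (m - ψ m) * (m - x') := by
      filter_upwards [Ioi_mem_nhds hx] with y hy using hwm_above y hy
    have hderiv := ((hasDerivAt_id' x).const_sub m).const_mul (vm (ψ m) m / (m - ψ m))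
    rw [hγw, hev.deriv_eq, hderiv.deriv, hwm_above x hx]
    field_simp
    ring
end

section
/- Let g : ℝ² → ℝ be C¹, let ψ : ℝ → ℝ be a strictly increasing C¹ bijection of ℝ onto ℝ with ψ(m) < m for all m, let X_0, α_0, α_1 ∈ ℝ, and define, for real x and m with ψ(m) ≤ x ≤ m, v(x, m) := g(ψ(m), m) − α_0 − α_1 x − ∫_{X_0}^{m} ∂_m g(ψ(ξ), ξ) · (x − ψ(ξ))/(ξ − ψ(ξ)) dξ − ∫_{ψ(X_0)}^{ψ(m)} ∂_x g(ξ, ψ^{-1}(ξ)) dξ. Then v is differentiable in m with ∂_m v(x, m) = ∂_m g(ψ(m), m) · (m − x)/(m − ψ(m)); in particular the Neumann boundary condition ∂_m v(x, m)|_{x=m} = 0 holds for every m. -/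
/-- The total derivative of a `C¹` function of two real variables takes the partial derivatives
as its values on the standard basis vectors. -/
theorem fderiv_uncurry_apply {g gx gm : ℝ → ℝ → ℝ}
    (hg : ContDiff ℝ 1 (Function.uncurry g))
    (hgx : ∀ x m, HasDerivAt (fun x' => g x' m) (gx x m) x)
    (hgm : ∀ x m, HasDerivAt (fun m' => g x m') (gm x m) m) (x m : ℝ) :
    fderiv ℝ (Function.uncurry g) (x, m) (1, 0) = gx x m ∧
      fderiv ℝ (Function.uncurry g) (x, m) (0, 1) = gm x m := by
  have hd := (hg.differentiable one_ne_zero (x, m)).hasFDerivAt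
  constructor
  · exact (hd.comp_hasDerivAt (f := fun x' : ℝ => (x', m)) x
      ((hasDerivAt_id x).prodMk (hasDerivAt_const x m))).unique (hgx x m)
  · exact (hd.comp_hasDerivAt (f := fun m' : ℝ => (x, m')) m
      ((hasDerivAt_const m x).prodMk (hasDerivAt_id m))).unique (hgm x m)

/-- The fundamental theorem of calculus for a globally continuous integrand. -/
theorem hasDerivAt_integral_of_continuous {f : ℝ → ℝ} (hf : Continuous f) (a b : ℝ) :
    HasDerivAt (fun u => ∫ t in a..u, f t) (f b) b :=
  (hf.integral_hasStrictDerivAt a b).hasDerivAt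


/-- Explicit candidate value function on the continuation region and the
Neumann boundary condition: for `g` C¹, `ψ` a strictly increasing C¹ bijection
of `ℝ` onto `ℝ` with `ψ(m) < m`, and `v` given by the explicit formula, `v` is
differentiable in `m` on `{ψ(m) ≤ x ≤ m}` with
`∂ₘv(x,m) = ∂ₘg(ψ(m),m)·(m−x)/(m−ψ(m))`; in particular `∂ₘv(x,m)|_{x=m} = 0`. -/
theorem candidate_value_neumann
    (g : ℝ → ℝ → ℝ) (hg : ContDiff ℝ 1 (Function.uncurry g))
    (gx gm : ℝ → ℝ → ℝ)
    (hgx : ∀ x m, HasDerivAt (fun x' => g x' m) (gx x m) x)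
    (hgm : ∀ x m, HasDerivAt (fun m' => g x m') (gm x m) m)
    (ψ : ℝ → ℝ) (hψ : ContDiff ℝ 1 ψ) (hψmono : StrictMono ψ)
    (hψbij : Function.Bijective ψ) (hψlt : ∀ m, ψ m < m)
    (ψinv : ℝ → ℝ)
    (hψinv₁ : Function.LeftInverse ψinv ψ)
    (hψinv₂ : Function.RightInverse ψinv ψ)
    (X₀ α₀ α₁ : ℝ)
    (v : ℝ → ℝ → ℝ)
    (hv : ∀ x m, v x m = g (ψ m) m - α₀ - α₁ * x
        - (∫ ξ in X₀..m, gm (ψ ξ) ξ * (x - ψ ξ) / (ξ - ψ ξ))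
        - (∫ ξ in ψ X₀..ψ m, gx ξ (ψinv ξ))) :
    (∀ x m : ℝ, ψ m ≤ x → x ≤ m →
      HasDerivAt (fun m' => v x m') (gm (ψ m) m * (m - x) / (m - ψ m)) m) ∧
    (∀ m : ℝ, HasDerivAt (fun m' => v m m') 0 m) := by
  have hpartial := fderiv_uncurry_apply hg hgx hgm
  have hfd := hg.continuous_fderiv one_ne_zero
  have hgxc : Continuous (Function.uncurry gx) := by
    have : Function.uncurry gx = fun p => fderiv ℝ (Function.uncurry g) p (1, 0) :=
      funext fun p => (hpartial p.1 p.2).1.symm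
    rw [this]
    fun_prop
  have hgmc : Continuous (Function.uncurry gm) := by
    have : Function.uncurry gm = fun p => fderiv ℝ (Function.uncurry g) p (0, 1) :=
      funext fun p => (hpartial p.1 p.2).2.symm
    rw [this]
    fun_prop
  have hψc := hψ.continuous
  have hinvc : Continuous ψinv :=
    (hψmono.orderIsoOfRightInverse ψ ψinv hψinv₂).symm.continuous
  have key : ∀ x m : ℝ,
      HasDerivAt (fun m' => v x m') (gm (ψ m) m * (m - x) / (m - ψ m)) m := by
    intro x m
    have hψ' := (hψ.differentiable one_ne_zero m).hasDerivAt
    have h1 : HasDerivAt (fun m' => g (ψ m') m') (gx (ψ m) m * deriv ψ m + gm (ψ m) m) m := by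
      have h := (hg.differentiable one_ne_zero (ψ m, m)).hasFDerivAt.comp_hasDerivAt
        (f := fun m' : ℝ => (ψ m', m')) m (hψ'.prodMk (hasDerivAt_id m))
      refine h.congr_deriv ?_
      have hsplit : ((deriv ψ m, 1) : ℝ × ℝ) = deriv ψ m • (1, 0) + (0, 1) := by simp
      rw [hsplit, map_add, map_smul, (hpartial _ _).1, (hpartial _ _).2, smul_eq_mul, mul_comm]
    have h2 := hasDerivAt_integral_of_continuous
      (f := fun ξ => gm (ψ ξ) ξ * (x - ψ ξ) / (ξ - ψ ξ))
      (((hgmc.comp (hψc.prodMk continuous_id)).mul (continuous_const.sub hψc)).div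
        (continuous_id.sub hψc) fun ξ => (sub_pos.2 (hψlt ξ)).ne') X₀ m
    have h3 := (hasDerivAt_integral_of_continuous (f := fun ξ => gx ξ (ψinv ξ))
      (hgxc.comp (continuous_id.prodMk hinvc)) (ψ X₀) (ψ m)).comp m hψ'
    have hne : m - ψ m ≠ 0 := (sub_pos.2 (hψlt m)).ne'
    rw [show (fun m' => v x m') = _ from funext (hv x)]
    refine ((((h1.sub_const α₀).sub_const (α₁ * x)).sub h2).sub h3).congr_deriv ?_
    rw [hψinv₁ m]
    field_simp
    ring
  exact ⟨fun x m _ _ => key x m, fun m => (key m m).congr_deriv (by simp)⟩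
end

section
/- Let v : ℝ² → ℝ be C², λ : ℝ → ℝ be C², and ψ : ℝ → ℝ be C¹ with ψ(m) < m for all m, define γ_v(x, m) := ∂²_{xm} v(x, m) + ∂_m v(x, m)/(m − x) for x < m, assume that for all m: −ψ′(m) · (∂²_{xx} v(ψ(m), m) − λ″(ψ(m))) = γ_v(ψ(m), m), and define w(x, m) := v(min(x, ψ(m)), m) − λ(min(x, ψ(m))) + (x − ψ(m))^+ · (∂_x v(ψ(m), m) − λ′(ψ(m))). If for every m the map x ↦ ∂_m v(x, m)/(m − x) is non-decreasing on (−∞, m), then for every m the map x ↦ ∂_m w(x, m)/(m − x) is non-decreasing on (−∞, m) (defined at x = ψ(m) by continuity). -/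
/-- Chain rule for `t ↦ f (ψ t) t` in terms of the partial derivatives of `f`. -/
theorem hasDerivAt_comp_diagonal {f : ℝ → ℝ → ℝ} (hf : Differentiable ℝ (Function.uncurry f))
    {ψ : ℝ → ℝ} {a b c m : ℝ}
    (hx : HasDerivAt (fun x => f x m) a (ψ m)) (hm : HasDerivAt (fun t => f (ψ m) t) b m)
    (hψ : HasDerivAt ψ c m) : HasDerivAt (fun t => f (ψ t) t) (a * c + b) m := by
  have hF := (hf (ψ m, m)).hasFDerivAt
  set L := fderiv ℝ (Function.uncurry f) (ψ m, m)
  have h1 : HasDerivAt (fun x => f x m) (L (1, 0)) (ψ m) :=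
    hF.comp_hasDerivAt (f := fun x => (x, m)) (ψ m)
      ((hasDerivAt_id (ψ m)).prodMk (hasDerivAt_const (ψ m) m))
  have h2 : HasDerivAt (fun t => f (ψ m) t) (L (0, 1)) m :=
    hF.comp_hasDerivAt (f := fun t => (ψ m, t)) m
      ((hasDerivAt_const m (ψ m)).prodMk (hasDerivAt_id m))
  have h3 : HasDerivAt (fun t => f (ψ t) t) (L (c, 1)) m :=
    hF.comp_hasDerivAt (f := fun t => (ψ t, t)) m (hψ.prodMk (hasDerivAt_id m))
  have hL : L (c, 1) = a * c + b := by
    have hc : ((c, 1) : ℝ × ℝ) = c • (1, 0) + (0, 1) := by simp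
    rw [hc, map_add, map_smul, smul_eq_mul, h1.unique hx, h2.unique hm, mul_comm]
  rwa [hL] at h3

/-- The first partial derivative of a `C²` function of two variables is jointly differentiable. -/
theorem differentiable_uncurry_partial {f fx : ℝ → ℝ → ℝ}
    (hf : ContDiff ℝ 2 (Function.uncurry f))
    (hx : ∀ x m, HasDerivAt (fun x' => f x' m) (fx x m) x) :
    Differentiable ℝ (Function.uncurry fx) := by
  have hfx : Function.uncurry fx = fun p => fderiv ℝ (Function.uncurry f) p (1, 0) := by
    funext ⟨x, m⟩
    have hF := (hf.differentiable (by norm_num) (x, m)).hasFDerivAt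
    have h1 : HasDerivAt (fun x' => f x' m) (fderiv ℝ (Function.uncurry f) (x, m) (1, 0)) x :=
      hF.comp_hasDerivAt (f := fun x' => (x', m)) x
        ((hasDerivAt_id x).prodMk (hasDerivAt_const x m))
    exact (hx x m).unique h1
  rw [hfx]
  have h : ContDiff ℝ 1 (fderiv ℝ (Function.uncurry f)) := hf.fderiv_right (by norm_num)
  exact (h.differentiable (by norm_num)).clm_apply (differentiable_const _)


/-- Propagation of Assumption B through the one-step construction: if
`x ↦ ∂ₘv(x,m)/(m−x)` is non-decreasing on `(−∞,m)` for every `m`, then so is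
`x ↦ ∂ₘw(x,m)/(m−x)` (defined at `x = ψ(m)` by continuity), where `w` is the
one-step candidate value function. -/
theorem assumption_B_propagates
    (v : ℝ → ℝ → ℝ) (hv : ContDiff ℝ 2 (Function.uncurry v))
    (vx vm vxx vxm : ℝ → ℝ → ℝ)
    (hvx : ∀ x m, HasDerivAt (fun x' => v x' m) (vx x m) x)
    (hvm : ∀ x m, HasDerivAt (fun m' => v x m') (vm x m) m)
    (hvxx : ∀ x m, HasDerivAt (fun x' => vx x' m) (vxx x m) x)
    (hvxm : ∀ x m, HasDerivAt (fun m' => vx x m') (vxm x m) m)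
    (lam : ℝ → ℝ) (hlam : ContDiff ℝ 2 lam)
    (lam' lam'' : ℝ → ℝ)
    (hlam' : ∀ x, HasDerivAt lam (lam' x) x)
    (hlam'' : ∀ x, HasDerivAt lam' (lam'' x) x)
    (ψ : ℝ → ℝ) (hψ : ContDiff ℝ 1 ψ)
    (ψ' : ℝ → ℝ) (hψ' : ∀ m, HasDerivAt ψ (ψ' m) m)
    (hψlt : ∀ m, ψ m < m)
    (γv : ℝ → ℝ → ℝ) (hγv : ∀ x m, γv x m = vxm x m + vm x m / (m - x))
    (hode : ∀ m, -ψ' m * (vxx (ψ m) m - lam'' (ψ m)) = γv (ψ m) m)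
    (w : ℝ → ℝ → ℝ)
    (hw : ∀ x m, w x m = v (min x (ψ m)) m - lam (min x (ψ m))
        + max (x - ψ m) 0 * (vx (ψ m) m - lam' (ψ m)))
    (hB : ∀ m, MonotoneOn (fun x => vm x m / (m - x)) (Set.Iio m))
    (wm : ℝ → ℝ → ℝ)
    (hwm : ∀ m x, x ≠ ψ m → HasDerivAt (fun m' => w x m') (wm x m) m)
    (hwm_bd : ∀ m, wm (ψ m) m = vm (ψ m) m) :
    ∀ m, MonotoneOn (fun x => wm x m / (m - x)) (Set.Iio m) := by
  intro m
  have hψc : ContinuousAt ψ m := hψ.continuous.continuousAt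
  have hbelow : ∀ x ≤ ψ m, wm x m = vm x m := by
    intro x hx
    rcases hx.eq_or_lt with rfl | hx
    · exact hwm_bd m
    refine (hwm m x hx.ne).unique (((hvm x m).sub_const (lam x)).congr_of_eventuallyEq ?_)
    filter_upwards [hψc.eventually (lt_mem_nhds hx)] with t ht
    rw [hw, min_eq_left ht.le, max_eq_right (by linarith)]
    ring
  have habove : ∀ x, ψ m ≤ x → x < m → wm x m / (m - x) = vm (ψ m) m / (m - ψ m) := by
    intro x hx hxm
    rcases hx.eq_or_lt with rfl | hx
    · rw [hwm_bd]
    have hv1 := hasDerivAt_comp_diagonal (hv.differentiable (by norm_num))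
      (hvx (ψ m) m) (hvm (ψ m) m) (hψ' m)
    have hv2 := hasDerivAt_comp_diagonal (differentiable_uncurry_partial hv hvx)
      (hvxx (ψ m) m) (hvxm (ψ m) m) (hψ' m)
    have hl1 := (hlam' (ψ m)).comp m (hψ' m)
    have hl2 := (hlam'' (ψ m)).comp m (hψ' m)
    have hd := (hv1.sub hl1).add (((hψ' m).const_sub x).mul (hv2.sub hl2))
    have heq := (hwm m x hx.ne').unique (hd.congr_of_eventuallyEq (by
      filter_upwards [hψc.eventually (gt_mem_nhds hx)] with t ht
      rw [hw, min_eq_right ht.le, max_eq_left (by linarith)]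
      rfl))
    simp only [Pi.sub_apply, Function.comp_apply] at heq
    have hode' := hode m
    rw [hγv] at hode'
    have hxm' : m - x ≠ 0 := by linarith
    have hψm : m - ψ m ≠ 0 := by linarith [hψlt m]
    have hq : vm (ψ m) m = vm (ψ m) m / (m - ψ m) * (m - ψ m) := by field_simp
    rw [div_eq_iff hxm', heq]
    linear_combination hq - (x - ψ m) * hode'
  intro x hx y hy hxy
  simp only [Set.mem_Iio] at hx hy
  change wm x m / (m - x) ≤ wm y m / (m - y)
  rcases le_total y (ψ m) with hyψ | hyψ
  · rw [hbelow x (hxy.trans hyψ), hbelow y hyψ]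
    exact hB m hx hy hxy
  rw [habove y hyψ hy]
  rcases le_total x (ψ m) with hxψ | hxψ
  · rw [hbelow x hxψ]
    exact hB m hx (hψlt m) hxψ
  · exact (habove x hxψ hx).le
end

section
/- Let g : ℝ² → ℝ be C², let b : ℝ → ℝ be C¹ and strictly increasing with b(y) > y for all y, fix ℓ ∈ ℝ, and define λ(x) := ∫_ℓ^x ∫_ℓ^y ∂_m g(ξ, b(ξ)) · b′(ξ)/(b(ξ) − ξ) dξ dy + ∫_ℓ^x ∂_x g(ξ, b(ξ)) dξ. Assume that for every M the map x ↦ ∂_m g(x, M)/(M − x) is non-decreasing on (−∞, M). Fix y₀ ≥ ℓ and set m := b(y₀). Then for every x with y₀ ≤ x ≤ m: [g(y₀, m) − λ(y₀)] + (x − y₀) · [∂_x g(y₀, m) − λ′(y₀)] − [g(x, m) − λ(x)] = ∫_{y₀}^{x} [ ∂_m g(x, b(y)) − ∂_m g(y, b(y)) · (b(y) − x)/(b(y) − y) ] b′(y) dy, and this quantity is non-negative. -/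
theorem partial_fst_eq_fderiv {g gx : ℝ → ℝ → ℝ} (hg : Differentiable ℝ (Function.uncurry g))
    (hgx : ∀ x m, HasDerivAt (fun x' => g x' m) (gx x m) x) (x m : ℝ) :
    gx x m = fderiv ℝ (Function.uncurry g) (x, m) (1, 0) := by
  have h : HasDerivAt (fun x' => Function.uncurry g (x', m))
      (fderiv ℝ (Function.uncurry g) (x, m) (1, 0)) x :=
    (hg (x, m)).hasFDerivAt.comp_hasDerivAt (l := Function.uncurry g) x
      ((hasDerivAt_id' x).prodMk (hasDerivAt_const x m))
  exact (hgx x m).unique h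

theorem partial_snd_eq_fderiv {g gm : ℝ → ℝ → ℝ} (hg : Differentiable ℝ (Function.uncurry g))
    (hgm : ∀ x m, HasDerivAt (fun m' => g x m') (gm x m) m) (x m : ℝ) :
    gm x m = fderiv ℝ (Function.uncurry g) (x, m) (0, 1) := by
  have h : HasDerivAt (fun m' => Function.uncurry g (x, m'))
      (fderiv ℝ (Function.uncurry g) (x, m) (0, 1)) m :=
    (hg (x, m)).hasFDerivAt.comp_hasDerivAt (l := Function.uncurry g) m
      ((hasDerivAt_const m x).prodMk (hasDerivAt_id' m))
  exact (hgm x m).unique h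

theorem continuous_partial_fst {g gx : ℝ → ℝ → ℝ} (hg : ContDiff ℝ 1 (Function.uncurry g))
    (hgx : ∀ x m, HasDerivAt (fun x' => g x' m) (gx x m) x) :
    Continuous (Function.uncurry gx) :=
  ((hg.continuous_fderiv one_ne_zero).clm_apply continuous_const).congr fun p =>
    (partial_fst_eq_fderiv (hg.differentiable one_ne_zero) hgx p.1 p.2).symm

theorem continuous_partial_snd {g gm : ℝ → ℝ → ℝ} (hg : ContDiff ℝ 1 (Function.uncurry g))
    (hgm : ∀ x m, HasDerivAt (fun m' => g x m') (gm x m) m) :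
    Continuous (Function.uncurry gm) :=
  ((hg.continuous_fderiv one_ne_zero).clm_apply continuous_const).congr fun p =>
    (partial_snd_eq_fderiv (hg.differentiable one_ne_zero) hgm p.1 p.2).symm

theorem hasDerivAt_along_graph_s16 {g gx gm : ℝ → ℝ → ℝ} {b : ℝ → ℝ} {y bd : ℝ}
    (hg : Differentiable ℝ (Function.uncurry g))
    (hgx : ∀ x m, HasDerivAt (fun x' => g x' m) (gx x m) x)
    (hgm : ∀ x m, HasDerivAt (fun m' => g x m') (gm x m) m)
    (hb : HasDerivAt b bd y) :
    HasDerivAt (fun z => g z (b z)) (gx y (b y) + gm y (b y) * bd) y := by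
  have h : HasDerivAt (fun z => Function.uncurry g (z, b z))
      (fderiv ℝ (Function.uncurry g) (y, b y) (1, bd)) y :=
    (hg (y, b y)).hasFDerivAt.comp_hasDerivAt (l := Function.uncurry g) y
      ((hasDerivAt_id' y).prodMk hb)
  refine h.congr_deriv ?_
  have hsplit : ((1, bd) : ℝ × ℝ) = (1, 0) + bd • (0, 1) := by simp
  rw [hsplit, map_add, map_smul, partial_fst_eq_fderiv hg hgx, partial_snd_eq_fderiv hg hgm,
    smul_eq_mul, mul_comm bd]

/-- Step 2 of the proof that the Azéma–Yor candidate value function dominates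
the obstacle: with `b` a smooth strictly increasing "barycenter" function with
`b(y) > y`, `λ` the candidate static hedge, `y₀ ≥ ℓ` and `m = b(y₀)`, for
`y₀ ≤ x ≤ m` the gap between the linear extension and the obstacle equals the
displayed integral, which is non-negative under Assumption B. -/
theorem azema_yor_obstacle_domination
    (g : ℝ → ℝ → ℝ) (hg : ContDiff ℝ 2 (Function.uncurry g))
    (gx gm : ℝ → ℝ → ℝ)
    (hgx : ∀ x m, HasDerivAt (fun x' => g x' m) (gx x m) x)
    (hgm : ∀ x m, HasDerivAt (fun m' => g x m') (gm x m) m)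
    (b : ℝ → ℝ) (hb : ContDiff ℝ 1 b) (hbmono : StrictMono b)
    (b' : ℝ → ℝ) (hb' : ∀ y, HasDerivAt b (b' y) y)
    (hby : ∀ y, y < b y)
    (ℓ : ℝ) (lam : ℝ → ℝ)
    (hlam : ∀ x, lam x =
        (∫ y in ℓ..x, ∫ ξ in ℓ..y, gm ξ (b ξ) * b' ξ / (b ξ - ξ))
        + ∫ ξ in ℓ..x, gx ξ (b ξ))
    (hB : ∀ M, MonotoneOn (fun x => gm x M / (M - x)) (Set.Iio M))
    (y₀ : ℝ) (hy₀ : ℓ ≤ y₀) (m : ℝ) (hm : m = b y₀) :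
    ∀ x, y₀ ≤ x → x ≤ m →
      ((g y₀ m - lam y₀) + (x - y₀) * (gx y₀ m - deriv lam y₀)
          - (g x m - lam x)
        = ∫ y in y₀..x, (gm x (b y) - gm y (b y) * (b y - x) / (b y - y)) * b' y) ∧
      0 ≤ ∫ y in y₀..x, (gm x (b y) - gm y (b y) * (b y - x) / (b y - y)) * b' y := by
  have hg1 : ContDiff ℝ 1 (Function.uncurry g) := hg.of_le one_le_two
  have hgxc := continuous_partial_fst hg1 hgx
  have hgmc := continuous_partial_snd hg1 hgm
  have hbc : Continuous b := hb.continuous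
  have hb'c : Continuous b' := by
    rw [show b' = deriv b from funext fun y => (hb' y).deriv.symm]
    exact hb.continuous_deriv le_rfl
  have hne : ∀ y, b y - y ≠ 0 := fun y => (sub_pos.2 (hby y)).ne'
  have hgmd : Continuous fun y => gm y (b y) := hgmc.comp (continuous_id.prodMk hbc)
  have hgxd : Continuous fun y => gx y (b y) := hgxc.comp (continuous_id.prodMk hbc)
  have hhc : Continuous fun ξ => gm ξ (b ξ) * b' ξ / (b ξ - ξ) :=
    (hgmd.mul hb'c).div (hbc.sub continuous_id) hne
  have hH : ∀ y, HasDerivAt (fun y => ∫ ξ in ℓ..y, gm ξ (b ξ) * b' ξ / (b ξ - ξ))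
      (gm y (b y) * b' y / (b y - y)) y := fun y =>
    (hhc.integral_hasStrictDerivAt ℓ y).hasDerivAt
  have hHc : Continuous fun y => ∫ ξ in ℓ..y, gm ξ (b ξ) * b' ξ / (b ξ - ξ) :=
    continuous_iff_continuousAt.2 fun y => (hH y).continuousAt
  have hlam' : ∀ y, HasDerivAt lam
      ((∫ ξ in ℓ..y, gm ξ (b ξ) * b' ξ / (b ξ - ξ)) + gx y (b y)) y := by
    intro y
    rw [show lam = _ from funext hlam]
    exact (hHc.integral_hasStrictDerivAt ℓ y).hasDerivAt.add
      (hgxd.integral_hasStrictDerivAt ℓ y).hasDerivAt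
  subst hm
  intro x hx hxm
  constructor
  · have hP : ∀ y, HasDerivAt
        (fun y => g x (b y) - g y (b y)
          + (x - y) * (∫ ξ in ℓ..y, gm ξ (b ξ) * b' ξ / (b ξ - ξ)) + lam y)
        ((gm x (b y) - gm y (b y) * (b y - x) / (b y - y)) * b' y) y := by
      intro y
      have h1 : HasDerivAt (fun y => g x (b y)) (gm x (b y) * b' y) y :=
        (hgm x (b y)).comp y (hb' y)
      have h2 := hasDerivAt_along_graph_s16 (hg1.differentiable one_ne_zero) hgx hgm (hb' y)
      refine (((h1.sub h2).add (((hasDerivAt_id y).const_sub x).mul (hH y))).add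
        (hlam' y)).congr_deriv ?_
      have := hne y
      simp only [id]
      field_simp
      ring
    have hc : Continuous fun y =>
        (gm x (b y) - gm y (b y) * (b y - x) / (b y - y)) * b' y :=
      ((hgmc.comp (continuous_const.prodMk hbc)).sub
        ((hgmd.mul (hbc.sub continuous_const)).div (hbc.sub continuous_id) hne)).mul hb'c
    rw [intervalIntegral.integral_eq_sub_of_hasDerivAt (fun y _ => hP y)
      (hc.intervalIntegrable _ _), (hlam' y₀).deriv]
    ring
  · rw [intervalIntegral.integral_of_le hx]
    refine MeasureTheory.setIntegral_nonneg measurableSet_Ioc fun y hy => ?_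
    have hyx : x < b y := hxm.trans_lt (hbmono hy.1)
    have hb'0 : 0 ≤ b' y := by
      rw [← (hb' y).deriv]
      exact hbmono.monotone.deriv_nonneg
    refine mul_nonneg (sub_nonneg.2 ?_) hb'0
    have h : gm y (b y) / (b y - y) ≤ gm x (b y) / (b y - x) := hB (b y) (hby y) hyx hy.2
    rw [le_div_iff₀ (sub_pos.2 hyx)] at h
    rwa [mul_div_right_comm]
end

section
/- Let g : ℝ² → ℝ be C², let b : ℝ → ℝ be C¹ and strictly increasing with b(y) > y for all y, fix ℓ ∈ ℝ, and define λ(x) := ∫_ℓ^x ∫_ℓ^y ∂_m g(ξ, b(ξ)) · b′(ξ)/(b(ξ) − ξ) dξ dy + ∫_ℓ^x ∂_x g(ξ, b(ξ)) dξ. Then λ is C² with λ″(x) = ∂²_{xx} g(x, b(x)) + [∂²_{xm} g(x, b(x)) + ∂_m g(x, b(x))/(b(x) − x)] · b′(x), so that ∂²_{xx}[g(·, m) − λ](x) = ∂²_{xx} g(x, m) − ∂²_{xx} g(x, b(x)) − [∂²_{xm} g(x, b(x)) + ∂_m g(x, b(x))/(b(x) − x)] · b′(x). Consequently, if for all x and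 m with b(x) ≤ m one has ∂²_{xx} g(x, m) − ∂²_{xx} g(x, b(x)) ≤ [∂²_{xm} g(x, b(x)) + ∂_m g(x, b(x))/(b(x) − x)] · b′(x), then for every m in the range of b the function x ↦ g(x, m) − λ(x) is concave on (−∞, b^{-1}(m)]. -/
/-- Chain rule along a graph `t ↦ (t, c t)` for a differentiable function of two real variables
with known partial derivatives. -/
theorem hasDerivAt_along_graph_s17 {F : ℝ → ℝ → ℝ} {c : ℝ → ℝ} {x c' Fx Fm : ℝ}
    (hF : DifferentiableAt ℝ (Function.uncurry F) (x, c x))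
    (hFx : HasDerivAt (fun t => F t (c x)) Fx x)
    (hFm : HasDerivAt (fun m => F x m) Fm (c x)) (hc : HasDerivAt c c' x) :
    HasDerivAt (fun t => F t (c t)) (Fx + Fm * c') x := by
  have h1 : HasDerivAt (fun t => F t (c x))
      (fderiv ℝ (Function.uncurry F) (x, c x) (1, 0)) x :=
    HasFDerivAt.comp_hasDerivAt (l := Function.uncurry F) x hF.hasFDerivAt
      ((hasDerivAt_id' x).prodMk (hasDerivAt_const x (c x)))
  have h2 : HasDerivAt (fun m => F x m)
      (fderiv ℝ (Function.uncurry F) (x, c x) (0, 1)) (c x) :=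
    HasFDerivAt.comp_hasDerivAt (l := Function.uncurry F) (c x) hF.hasFDerivAt
      ((hasDerivAt_const (c x) x).prodMk (hasDerivAt_id' (c x)))
  have h3 : HasDerivAt (fun t => F t (c t))
      (fderiv ℝ (Function.uncurry F) (x, c x) (1, c')) x :=
    HasFDerivAt.comp_hasDerivAt (l := Function.uncurry F) x hF.hasFDerivAt
      ((hasDerivAt_id' x).prodMk hc)
  have h4 : ((1, c') : ℝ × ℝ) = (1, 0) + c' • (0, 1) := by simp
  rw [h4, map_add, map_smul, h1.unique hFx, h2.unique hFm, smul_eq_mul, mul_comm] at h3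
  exact h3

/-- The first partial derivative of a `C^(n+1)` function of two variables is `C^n`. -/
theorem contDiff_uncurry_partial_fst {n : WithTop ℕ∞} {F Fx : ℝ → ℝ → ℝ}
    (hF : ContDiff ℝ (n + 1) (Function.uncurry F))
    (hFx : ∀ x m, HasDerivAt (fun t => F t m) (Fx x m) x) :
    ContDiff ℝ n (Function.uncurry Fx) := by
  have h : Function.uncurry Fx = fun p => fderiv ℝ (Function.uncurry F) p (1, 0) := by
    funext ⟨x, m⟩
    have hd := (hF.differentiable (by simp) (x, m)).hasFDerivAt
    exact (hFx x m).unique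
      (HasFDerivAt.comp_hasDerivAt (l := Function.uncurry F) x hd
        ((hasDerivAt_id' x).prodMk (hasDerivAt_const x m)))
  rw [h]
  exact (hF.fderiv_right le_rfl).clm_apply contDiff_const

/-- The second partial derivative of a `C^(n+1)` function of two variables is `C^n`. -/
theorem contDiff_uncurry_partial_snd {n : WithTop ℕ∞} {F Fm : ℝ → ℝ → ℝ}
    (hF : ContDiff ℝ (n + 1) (Function.uncurry F))
    (hFm : ∀ x m, HasDerivAt (fun t => F x t) (Fm x m) m) :
    ContDiff ℝ n (Function.uncurry Fm) := by
  have h : Function.uncurry Fm = fun p => fderiv ℝ (Function.uncurry F) p (0, 1) := by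
    funext ⟨x, m⟩
    have hd := (hF.differentiable (by simp) (x, m)).hasFDerivAt
    exact (hFm x m).unique
      (HasFDerivAt.comp_hasDerivAt (l := Function.uncurry F) m hd
        ((hasDerivAt_const m x).prodMk (hasDerivAt_id' m)))
  rw [h]
  exact (hF.fderiv_right le_rfl).clm_apply contDiff_const

/-- A function with continuous second derivative is `C²`. -/
theorem contDiff_two_of_hasDerivAt {f f' f'' : ℝ → ℝ} (hf : ∀ x, HasDerivAt f (f' x) x)
    (hf' : ∀ x, HasDerivAt f' (f'' x) x) (hf'' : Continuous f'') : ContDiff ℝ 2 f := by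
  have h1 : deriv f = f' := funext fun x => (hf x).deriv
  have h2 : deriv f' = f'' := funext fun x => (hf' x).deriv
  rw [show (2 : WithTop ℕ∞) = 1 + 1 by norm_num, contDiff_succ_iff_deriv, h1,
    contDiff_one_iff_deriv, h2]
  exact ⟨fun x => (hf x).differentiableAt, by simp, fun x => (hf' x).differentiableAt, hf''⟩


/-- The candidate static hedge `λ` is C² with the explicit second derivative,
and consequently (under the paper's Assumption C) `x ↦ g(x,m) − λ(x)` is
concave below the Azéma–Yor free boundary `b⁻¹(m)` for every `m` in the range
of `b`. -/
theorem static_hedge_second_derivative_and_concavity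
    (g : ℝ → ℝ → ℝ) (hg : ContDiff ℝ 2 (Function.uncurry g))
    (gx gm gxx gxm : ℝ → ℝ → ℝ)
    (hgx : ∀ x m, HasDerivAt (fun x' => g x' m) (gx x m) x)
    (hgm : ∀ x m, HasDerivAt (fun m' => g x m') (gm x m) m)
    (hgxx : ∀ x m, HasDerivAt (fun x' => gx x' m) (gxx x m) x)
    (hgxm : ∀ x m, HasDerivAt (fun m' => gx x m') (gxm x m) m)
    (b : ℝ → ℝ) (hb : ContDiff ℝ 1 b) (hbmono : StrictMono b)
    (b' : ℝ → ℝ) (hb' : ∀ y, HasDerivAt b (b' y) y)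
    (hby : ∀ y, y < b y)
    (ℓ : ℝ) (lam : ℝ → ℝ)
    (hlam : ∀ x, lam x =
        (∫ y in ℓ..x, ∫ ξ in ℓ..y, gm ξ (b ξ) * b' ξ / (b ξ - ξ))
        + ∫ ξ in ℓ..x, gx ξ (b ξ)) :
    ContDiff ℝ 2 lam ∧
    (∀ x, deriv (deriv lam) x
        = gxx x (b x) + (gxm x (b x) + gm x (b x) / (b x - x)) * b' x) ∧
    (∀ m x : ℝ, deriv (deriv (fun x' => g x' m - lam x')) x
        = gxx x m - gxx x (b x)
          - (gxm x (b x) + gm x (b x) / (b x - x)) * b' x) ∧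
    ((∀ x M : ℝ, b x ≤ M →
        gxx x M - gxx x (b x) ≤ (gxm x (b x) + gm x (b x) / (b x - x)) * b' x) →
      ∀ y : ℝ, ConcaveOn ℝ (Set.Iic y) (fun x => g x (b y) - lam x)) := by
  have hg' : ContDiff ℝ (1 + 1) (Function.uncurry g) := by
    rwa [show (1 + 1 : WithTop ℕ∞) = 2 by norm_num]
  have hGX : ContDiff ℝ 1 (Function.uncurry gx) := contDiff_uncurry_partial_fst hg' hgx
  have hGM : Continuous (Function.uncurry gm) :=
    (contDiff_uncurry_partial_snd hg' hgm).continuous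
  have hGX' : ContDiff ℝ (0 + 1) (Function.uncurry gx) := by rwa [zero_add]
  have hGXX : Continuous (Function.uncurry gxx) :=
    (contDiff_uncurry_partial_fst hGX' hgxx).continuous
  have hGXM : Continuous (Function.uncurry gxm) :=
    (contDiff_uncurry_partial_snd hGX' hgxm).continuous
  have hgraph : Continuous fun x => (x, b x) := continuous_id.prodMk hb.continuous
  have hb'c : Continuous b' := by
    rw [← funext fun x => (hb' x).deriv]
    exact hb.continuous_deriv le_rfl
  have hfc : Continuous fun ξ => gm ξ (b ξ) * b' ξ / (b ξ - ξ) :=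
    ((hGM.comp hgraph).mul hb'c).div (hb.continuous.sub continuous_id)
      fun x => (sub_pos.2 (hby x)).ne'
  have hhc : Continuous fun ξ => gx ξ (b ξ) := hGX.continuous.comp hgraph
  have hlam1 : ∀ x, HasDerivAt lam
      ((∫ ξ in ℓ..x, gm ξ (b ξ) * b' ξ / (b ξ - ξ)) + gx x (b x)) x := by
    intro x
    rw [funext hlam]
    have hIc : Continuous fun y => ∫ ξ in ℓ..y, gm ξ (b ξ) * b' ξ / (b ξ - ξ) :=
      continuous_iff_continuousAt.2 fun y =>
        (hfc.integral_hasStrictDerivAt ℓ y).hasDerivAt.continuousAt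
    exact (hIc.integral_hasStrictDerivAt ℓ x).hasDerivAt.add
      (hhc.integral_hasStrictDerivAt ℓ x).hasDerivAt
  have hlam2 : ∀ x, HasDerivAt
      (fun x => (∫ ξ in ℓ..x, gm ξ (b ξ) * b' ξ / (b ξ - ξ)) + gx x (b x))
      (gxx x (b x) + (gxm x (b x) + gm x (b x) / (b x - x)) * b' x) x := by
    intro x
    refine ((hfc.integral_hasStrictDerivAt ℓ x).hasDerivAt.add
      (hasDerivAt_along_graph_s17 (hGX.differentiable (by simp) _) (hgxx x (b x)) (hgxm x (b x))
        (hb' x))).congr_deriv ?_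
    ring
  have hlam2c : Continuous fun x =>
      gxx x (b x) + (gxm x (b x) + gm x (b x) / (b x - x)) * b' x :=
    (hGXX.comp hgraph).add (((hGXM.comp hgraph).add ((hGM.comp hgraph).div
      (hb.continuous.sub continuous_id) fun x => (sub_pos.2 (hby x)).ne')).mul hb'c)
  have hd1 := fun m x => (hgx x m).sub (hlam1 x)
  have hd2 := fun m x => (hgxx x m).sub (hlam2 x)
  refine ⟨contDiff_two_of_hasDerivAt hlam1 hlam2 hlam2c, fun x => ?_, fun m x => ?_,
    fun hC y => ?_⟩
  · rw [funext fun x => (hlam1 x).deriv]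
    exact (hlam2 x).deriv
  · have h : deriv (fun x' => g x' m - lam x') = _ := funext fun x => (hd1 m x).deriv
    rw [h]
    exact (hd2 m x).deriv.trans (by ring)
  · refine concaveOn_of_hasDerivWithinAt2_nonpos (convex_Iic y)
      (fun x _ => (hd1 (b y) x).continuousAt.continuousWithinAt)
      (fun x _ => (hd1 (b y) x).hasDerivWithinAt)
      (fun x _ => (hd2 (b y) x).hasDerivWithinAt) fun x hx => ?_
    have := hC x (b y) (hbmono.monotone (Set.mem_Iic.1 (interior_subset (s := Set.Iic y) hx)))
    linarith
end
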